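/- arXiv:1711.07734 — 4 statements merged into one kernel-verified Lean document; each statement's English description precedes it below -/
import Mathlib

section
/- For every integer n ≥ 22, the graph K₅ + (K₂ ∪ \overline{K_{n−7}}) (the join of the complete graph on 5 vertices with the disjoint union of an edge and n−7 isolated vertices) contains no subgraph isomorphic to 2P₇ and has exactly 5n − 14 edges. -/
open SimpleGraph

/-- `H` is contained in `G` as a subgraph, i.e. there is an injective graph
homomorphism from `H` to `G` (a copy of `H` in `G`). -/
def Contains {α β : Type*} (H : SimpleGraph α) (G : SimpleGraph β) : Prop :=
  ∃ f : H →g G, Function.Injective f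

/-- `2P₇`: the disjoint union of two copies of the path on 7 vertices. -/
def TwoP7 : SimpleGraph (Fin 7 ⊕ Fin 7) :=
  SimpleGraph.pathGraph 7 ⊕g SimpleGraph.pathGraph 7

/-- The graph `K₅ + (K₂ ∪ K̄_{n-7})` on `Fin n`: vertices `0,…,4` form a `K₅`
joined to everything, vertices `5,6` form an edge, and vertices `7,…,n-1`
are otherwise isolated. -/
def joinGraph (n : ℕ) : SimpleGraph (Fin n) :=
  SimpleGraph.fromRel (fun u v => u.val < 5 ∨ (u.val ≤ 6 ∧ v.val ≤ 6))

theorem joinGraph_adj {n : ℕ} {u v : Fin n} :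
    (joinGraph n).Adj u v ↔ u ≠ v ∧ (u.val < 5 ∨ v.val < 5 ∨ (u.val ≤ 6 ∧ v.val ≤ 6)) := by
  rw [joinGraph, fromRel_adj]
  tauto

/-- Every copy of `P₇` in `joinGraph n` uses at least three of the five dominating vertices. -/
theorem three_le_card_dominating {n : ℕ} (f : pathGraph 7 →g joinGraph n)
    (hf : Function.Injective f) :
    3 ≤ (Finset.univ.filter fun i => (f i).val < 5).card := by
  have edge (i j : Fin 7) (h : i.val + 1 = j.val) :
      (f i).val < 5 ∨ (f j).val < 5 ∨ ((f i).val ≤ 6 ∧ (f j).val ≤ 6) :=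
    (joinGraph_adj.1 (f.map_adj (pathGraph_adj.2 (Or.inl h)))).2
  have ne (i j : Fin 7) (h : i ≠ j) : (f i).val ≠ (f j).val :=
    fun e => h (hf (Fin.ext e))
  have := edge 0 1 rfl
  have := edge 1 2 rfl
  have := edge 2 3 rfl
  have := edge 3 4 rfl
  have := edge 4 5 rfl
  have := edge 5 6 rfl
  rw [Finset.card_filter]
  simp only [Fin.sum_univ_seven]
  grind

theorem not_contains_twoP7_joinGraph (n : ℕ) : ¬ Contains TwoP7 (joinGraph n) := by
  rintro ⟨f, hf⟩
  have hl := three_le_card_dominating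
    (f.comp (Embedding.sumInl (G := pathGraph 7) (H := pathGraph 7)).toHom)
    (hf.comp Sum.inl_injective)
  have hr := three_le_card_dominating
    (f.comp (Embedding.sumInr (G := pathGraph 7) (H := pathGraph 7)).toHom)
    (hf.comp Sum.inr_injective)
  have hle : (Finset.univ.filter fun x => (f x).val < 5).card ≤ (Finset.range 5).card :=
    Finset.card_le_card_of_injOn (fun x => (f x).val) (fun x hx => by simpa using hx)
      (fun x _ y _ h => hf (Fin.ext h))
  rw [Finset.card_filter, Fintype.sum_sum_type, ← Finset.card_filter, ← Finset.card_filter,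
    Finset.card_range] at hle
  have : 3 + 3 ≤ 5 := (Nat.add_le_add hl hr).trans hle
  omega

open Classical in
theorem joinGraph_degree {n : ℕ} (hn : 7 ≤ n) (v : Fin n) :
    (joinGraph n).degree v = if v.val < 5 then n - 1 else if v.val < 7 then 6 else 5 := by
  have card_lt {k : ℕ} (hk : k ≤ n) : (Finset.univ.filter fun u : Fin n => u.val < k).card = k := by
    rw [Fin.card_filter_val_lt, min_eq_right hk]
  rw [← card_neighborFinset_eq_degree]
  split_ifs with h5 h7
  · have : (joinGraph n).neighborFinset v = Finset.univ.erase v := by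
      ext u
      simp [joinGraph_adj, h5, eq_comm]
    simp [this]
  · have : (joinGraph n).neighborFinset v =
        (Finset.univ.filter fun u : Fin n => u.val < 7).erase v := by
      ext u
      simp only [mem_neighborFinset, joinGraph_adj, Finset.mem_erase, Finset.mem_filter_univ,
        Ne, Fin.ext_iff]
      omega
    rw [this, Finset.card_erase_of_mem (by simpa using h7), card_lt hn]
  · have : (joinGraph n).neighborFinset v = Finset.univ.filter fun u : Fin n => u.val < 5 := by
      ext u
      simp only [mem_neighborFinset, joinGraph_adj, Finset.mem_filter_univ, Ne, Fin.ext_iff]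
      omega
    rw [this, card_lt (by omega)]

theorem joinGraph_ncard_edgeSet {n : ℕ} (hn : 7 ≤ n) :
    (joinGraph n).edgeSet.ncard = 5 * n - 14 := by
  classical
  have hsum := (joinGraph n).sum_degrees_eq_twice_card_edges
  simp only [joinGraph_degree hn] at hsum
  rw [Fin.sum_univ_eq_sum_range
    (fun i => if i < 5 then n - 1 else if i < 7 then 6 else 5)] at hsum
  obtain ⟨m, rfl⟩ := Nat.exists_eq_add_of_le hn
  rw [Finset.sum_range_add] at hsum
  have not_lt (x : ℕ) : ¬ 7 + x < 5 := by omega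
  simp [Finset.sum_range_succ, not_lt] at hsum
  rw [← coe_edgeFinset, Set.ncard_coe_finset]
  omega

/-- For `n ≥ 22`, the graph `K₅ + (K₂ ∪ K̄_{n-7})` is `2P₇`-free and has
exactly `5n - 14` edges. -/
theorem stmt1 (n : ℕ) (hn : 22 ≤ n) :
    ¬ Contains TwoP7 (joinGraph n) ∧ (joinGraph n).edgeSet.ncard = 5 * n - 14 := by
  exact ⟨not_contains_twoP7_joinGraph n, joinGraph_ncard_edgeSet (by omega)⟩
end

section
/- Let G be a 2P₇-free graph and let x₁x₂…x₁₃ be a path in G on 13 distinct vertices. If y₁, y₂, y₃ are distinct vertices outside {x₁,…,x₁₃} with y₁ adjacent to y₂ and y₂ adjacent to y₃ (a path P₃ in G − P₁₃), and y₁ is adjacent to some vertex of the path, then x₇ is the only vertex of the path adjacent to y₁. -/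
open SimpleGraph

/-- Two vertex-disjoint paths on seven vertices form a copy of `2P₇`. -/
theorem contains_twoP7_of_disjoint_paths {V : Type*} {G : SimpleGraph V} {p q : Fin 7 → V}
    (hp : Function.Injective p) (hq : Function.Injective q)
    (hpadj : ∀ i : Fin 6, G.Adj (p i.castSucc) (p i.succ))
    (hqadj : ∀ i : Fin 6, G.Adj (q i.castSucc) (q i.succ))
    (hpq : ∀ i j, p i ≠ q j) : Contains TwoP7 G := by
  have adj_of_path {r : Fin 7 → V} (hr : ∀ i : Fin 6, G.Adj (r i.castSucc) (r i.succ))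
      {a b : Fin 7} (hab : (pathGraph 7).Adj a b) : G.Adj (r a) (r b) := by
    have step {a b : Fin 7} (h : a.val + 1 = b.val) : G.Adj (r a) (r b) := by
      convert hr ⟨a, by omega⟩ using 2 <;> ext <;> simp [← h]
    rcases pathGraph_adj.mp hab with h | h
    · exact step h
    · exact (step h).symm
  refine ⟨⟨Sum.elim p q, ?_⟩, hp.sumElim hq hpq⟩
  rintro (a | a) (b | b) hab
  · exact adj_of_path hpadj hab
  · simp [TwoP7] at hab
  · simp [TwoP7] at hab
  · exact adj_of_path hqadj hab

/-- In a `2P₇`-free graph, an end of a three-vertex path disjoint from a path on 13 vertices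
has no neighbour among the first six vertices of the latter. -/
theorem not_adj_of_lt_six {V : Type*} {G : SimpleGraph V} (hfree : ¬ Contains TwoP7 G)
    {x : Fin 13 → V} (hinj : Function.Injective x)
    (hpath : ∀ i : Fin 12, G.Adj (x i.castSucc) (x i.succ))
    {y₁ y₂ y₃ : V} (h13 : y₁ ≠ y₃)
    (hy₁ : y₁ ∉ Set.range x) (hy₂ : y₂ ∉ Set.range x) (hy₃ : y₃ ∉ Set.range x)
    (ha : G.Adj y₁ y₂) (hb : G.Adj y₂ y₃) {i : Fin 13} (hi : i < 6) :
    ¬ G.Adj y₁ (x i) := by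
  intro hadj
  -- Four consecutive vertices among the first six, starting at `x i`, in either direction.
  obtain ⟨s, hs, hs_inj, hs_lt, hs_adj⟩ : ∃ s : Fin 4 → Fin 13, s 0 = i ∧ Function.Injective s ∧
      (∀ j, s j < 6) ∧ ∀ j : Fin 3, G.Adj (x (s j.castSucc)) (x (s j.succ)) := by
    rcases le_or_gt i 2 with h | h
    · refine ⟨fun j => ⟨i + j, by omega⟩, by simp, fun a b hab => ?_, fun j => ?_, fun j => ?_⟩
      · simp only [Fin.mk.injEq] at hab
        omega
      · simp only [Fin.lt_def] at *
        simp at *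
        omega
      · exact hpath ⟨i + j, by omega⟩
    · refine ⟨fun j => ⟨i - j, by omega⟩, by simp, fun a b hab => ?_, fun j => ?_, fun j => ?_⟩
      · simp only [Fin.mk.injEq] at hab
        omega
      · simp only [Fin.lt_def] at *
        simp at *
        omega
      · convert (hpath ⟨i - j - 1, by omega⟩).symm using 2 <;> ext <;> simp <;> omega
  simp only [Set.mem_range, not_exists] at hy₁ hy₂ hy₃
  refine hfree (contains_twoP7_of_disjoint_paths
    (p := Fin.append ![y₃, y₂, y₁] (x ∘ s)) (q := fun j => x (j.natAdd 6)) ?_ ?_ ?_ ?_ ?_)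
  · refine Fin.append_injective_iff.mpr ⟨?_, hinj.comp hs_inj, ?_⟩
    · intro a b
      fin_cases a <;> fin_cases b <;> simp [h13, h13.symm, ha.ne, ha.ne', hb.ne, hb.ne']
    · intro a b
      fin_cases a
      · exact Ne.symm (hy₃ _)
      · exact Ne.symm (hy₂ _)
      · exact Ne.symm (hy₁ _)
  · exact hinj.comp (Fin.natAdd_injective 7 6)
  · intro j
    fin_cases j
    · exact hb.symm
    · exact ha.symm
    · exact show G.Adj y₁ (x (s 0)) from hs.symm ▸ hadj
    · exact hs_adj 0
    · exact hs_adj 1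
    · exact hs_adj 2
  · exact fun j => hpath (j.natAdd 6)
  · intro a b
    refine Fin.addCases (m := 3) (n := 4) (fun a => ?_) (fun a => ?_) a
    · rw [Fin.append_left]
      fin_cases a
      · exact Ne.symm (hy₃ _)
      · exact Ne.symm (hy₂ _)
      · exact Ne.symm (hy₁ _)
    · rw [Fin.append_right]
      refine hinj.ne (ne_of_lt ((hs_lt a).trans_le ?_))
      exact Fin.le_def.mpr (Nat.le_add_right 6 b)

/-- In a `2P₇`-free graph with a path `x₁x₂…x₁₃` on 13 distinct vertices, if
`y₁y₂y₃` is a path on three distinct vertices outside the path and `y₁` is adjacent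
to some vertex of the path, then `x₇` (0-based index `6`) is the only vertex of
the path adjacent to `y₁`. -/
theorem stmt9 {V : Type*} (G : SimpleGraph V) (hfree : ¬ Contains TwoP7 G)
    (x : Fin 13 → V) (hinj : Function.Injective x)
    (hpath : ∀ i : Fin 12, G.Adj (x i.castSucc) (x i.succ))
    (y₁ y₂ y₃ : V) (h12 : y₁ ≠ y₂) (h13 : y₁ ≠ y₃) (h23 : y₂ ≠ y₃)
    (hy₁ : y₁ ∉ Set.range x) (hy₂ : y₂ ∉ Set.range x) (hy₃ : y₃ ∉ Set.range x)
    (ha : G.Adj y₁ y₂) (hb : G.Adj y₂ y₃)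
    (hhit : ∃ i : Fin 13, G.Adj y₁ (x i)) :
    ∀ i : Fin 13, G.Adj y₁ (x i) → i = 6 := by
  intro i hi
  by_contra hne
  rcases lt_or_gt_of_ne hne with h | h
  · exact not_adj_of_lt_six hfree hinj hpath h13 hy₁ hy₂ hy₃ ha hb h hi
  · have hrange : Set.range (x ∘ Fin.rev) = Set.range x := Fin.rev_surjective.range_comp x
    refine not_adj_of_lt_six (x := x ∘ Fin.rev) (i := i.rev) hfree
      (hinj.comp Fin.rev_injective) (fun j => ?_) h13 (hrange ▸ hy₁) (hrange ▸ hy₂)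
      (hrange ▸ hy₃) ha hb (Fin.rev_lt_iff.mpr h) ?_
    · simpa [Fin.rev_castSucc, Fin.rev_succ] using (hpath j.rev).symm
    · simpa using hi
end

section
/- Let G be a 2P₇-free graph and let x₁x₂…x₁₃ be a path in G on 13 distinct vertices. If some vertex of G outside {x₁,…,x₁₃} is adjacent to at least one vertex of the path, then the number of edges of G with both endpoints in {x₁,…,x₁₃} is at most 74. -/
open SimpleGraph

/-- Cutting a path on 14 vertices in the middle gives a copy of `2P₇`. -/
lemma contains_twoP7_of_path {V : Type*} {G : SimpleGraph V} (p : Fin 14 → V)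
    (hp : Function.Injective p) (hadj : ∀ i : Fin 13, G.Adj (p i.castSucc) (p i.succ)) :
    Contains TwoP7 G := by
  have hstep : ∀ a b : Fin 14, a.val + 1 = b.val → G.Adj (p a) (p b) := by
    intro a b h
    have h' := hadj ⟨a, by omega⟩
    have ha : (⟨a, by omega⟩ : Fin 13).castSucc = a := rfl
    have hb : (⟨a, by omega⟩ : Fin 13).succ = b := Fin.ext h
    rwa [ha, hb] at h'
  let e : Fin 7 ⊕ Fin 7 → Fin 14 := finSumFinEquiv
  have hl : ∀ a, (e (.inl a)).val = a := fun _ => rfl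
  have hr : ∀ a, (e (.inr a)).val = 7 + a := fun _ => rfl
  refine ⟨⟨fun s => p (e s), ?_⟩, hp.comp finSumFinEquiv.injective⟩
  rintro (a | a) (b | b) h
  · rcases pathGraph_adj.1 (show (pathGraph 7).Adj a b from h) with h | h
    · exact hstep _ _ (by rw [hl, hl, h])
    · exact (hstep _ _ (by rw [hl, hl, h])).symm
  · exact absurd h Bool.false_ne_true
  · exact absurd h Bool.false_ne_true
  · rcases pathGraph_adj.1 (show (pathGraph 7).Adj a b from h) with h | h
    · exact hstep _ _ (by rw [hr, hr, add_assoc, h])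
    · exact (hstep _ _ (by rw [hr, hr, add_assoc, h])).symm

/-- A 13-cycle together with a pendant edge contains `2P₇`. -/
lemma contains_twoP7_of_cycle {V : Type*} {G : SimpleGraph V} (c : Fin 13 → V)
    (hc : Function.Injective c) (hadj : ∀ i, G.Adj (c i) (c (i + 1))) {y : V}
    (hy : y ∉ Set.range c) {m : Fin 13} (hm : G.Adj y (c m)) : Contains TwoP7 G := by
  refine contains_twoP7_of_path (Fin.cons y fun t => c (m + t)) ?_ fun i => ?_
  · refine Fin.cons_injective_iff.2 ⟨?_, hc.comp (add_right_injective m)⟩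
    rintro ⟨t, ht⟩
    exact hy ⟨_, ht⟩
  · induction i using Fin.cases with
    | zero => simpa using hm
    | succ j =>
      have h := hadj (m + j.castSucc)
      rw [add_assoc, Fin.coeSucc_eq_succ] at h
      simpa [← Fin.succ_castSucc] using h

/-- The order in which the closed walk `0, …, k, 12, 11, …, k + 1` visits its vertices. -/
def flipTail (k j : Fin 13) : Fin 13 :=
  if j ≤ k then j else k - j

lemma flipTail_injective (k : Fin 13) : Function.Injective (flipTail k) := by
  revert k
  unfold Function.Injective
  decide

lemma flipTail_step : ∀ k : Fin 10, ∀ j : Fin 13,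
    let a := flipTail ⟨k + 1, by omega⟩ j
    let b := flipTail ⟨k + 1, by omega⟩ (j + 1)
    a.val + 1 = b.val ∨ b.val + 1 = a.val ∨ (a.val = k + 1 ∧ b = 12) ∨ (a.val = k + 2 ∧ b = 0) := by
  decide

/-- If both chords `{0, k + 2}` and `{k + 1, 12}` of a 13-vertex path are present, the path closes
up to a spanning cycle, so a pendant edge yields `2P₇`. -/
lemma contains_twoP7_of_chords {V : Type*} {G : SimpleGraph V} {x : Fin 13 → V}
    (hinj : Function.Injective x) (hpath : ∀ i : Fin 12, G.Adj (x i.castSucc) (x i.succ))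
    {y : V} (hy : y ∉ Set.range x) {i : Fin 13} (hi : G.Adj y (x i)) (k : Fin 10)
    (hfst : G.Adj (x 0) (x ⟨k + 2, by omega⟩)) (hlst : G.Adj (x ⟨k + 1, by omega⟩) (x 12)) :
    Contains TwoP7 G := by
  have hstep : ∀ a b : Fin 13, a.val + 1 = b.val → G.Adj (x a) (x b) := by
    intro a b h
    have h' := hpath ⟨a, by omega⟩
    have ha : (⟨a, by omega⟩ : Fin 12).castSucc = a := rfl
    have hb : (⟨a, by omega⟩ : Fin 12).succ = b := Fin.ext h
    rwa [ha, hb] at h'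
  let q : Fin 13 → Fin 13 := flipTail ⟨k + 1, by omega⟩
  have hq : Function.Injective q := flipTail_injective _
  obtain ⟨m, rfl⟩ := Finite.surjective_of_injective hq i
  refine contains_twoP7_of_cycle (x ∘ q) (hinj.comp hq) (fun j => ?_) ?_ hi
  · change G.Adj (x (q j)) (x (q (j + 1)))
    rcases flipTail_step k j with h | h | ⟨h, h'⟩ | ⟨h, h'⟩
    · exact hstep _ _ h
    · exact (hstep _ _ h).symm
    · rw [show q j = ⟨k + 1, by omega⟩ from Fin.ext h, show q (j + 1) = 12 from h']
      exact hlst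
    · rw [show q j = ⟨k + 2, by omega⟩ from Fin.ext h, show q (j + 1) = 0 from h']
      exact hfst.symm
  · rintro ⟨t, ht⟩
    exact hy ⟨_, ht⟩

lemma chords_disjoint : ∀ k l : Fin 10, k ≠ l →
    ∀ e ∈ [s((0 : Fin 13), ⟨k + 2, by omega⟩), s(⟨k + 1, by omega⟩, 12)],
    ∀ f ∈ [s((0 : Fin 13), ⟨l + 2, by omega⟩), s(⟨l + 1, by omega⟩, 12)], e ≠ f := by
  intro k l hkl e he f hf
  simp only [List.mem_cons, List.not_mem_nil, or_false] at he hf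
  have hkl' : k.val ≠ l.val := fun h => hkl (Fin.ext h)
  rcases he with rfl | rfl <;> rcases hf with rfl | rfl <;>
    simp only [ne_eq, Sym2.eq_iff, Fin.ext_iff] <;> grind

lemma chords_not_isDiag : ∀ k : Fin 10,
    ∀ e ∈ [s((0 : Fin 13), ⟨k + 2, by omega⟩), s(⟨k + 1, by omega⟩, 12)], ¬ e.IsDiag := by
  decide

/-- Fact 1: if some vertex outside the 13-vertex path hits the path, then there are at most 74 edges with both endpoints on the path. -/
theorem stmt10 {V : Type*} [Fintype V] (G : SimpleGraph V) (hfree : ¬ Contains TwoP7 G)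
    (x : Fin 13 → V) (hinj : Function.Injective x)
    (hpath : ∀ i : Fin 12, G.Adj (x i.castSucc) (x i.succ))
    (hhit : ∃ y, y ∉ Set.range x ∧ ∃ i : Fin 13, G.Adj y (x i)) :
    ({e : Sym2 V | e ∈ G.edgeSet ∧ ∀ v ∈ e, v ∈ Set.range x}).ncard ≤ 74 := by
  obtain ⟨y, hy, i, hi⟩ := hhit
  have hmissing : ∀ k : Fin 10,
      ∃ e ∈ [s((0 : Fin 13), ⟨k + 2, by omega⟩), s(⟨k + 1, by omega⟩, 12)],
        e.map x ∉ G.edgeSet := by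
    intro k
    by_contra! h
    exact hfree (contains_twoP7_of_chords hinj hpath hy hi k
      (by simpa using h s(_, _) List.mem_cons_self)
      (by simpa using h s(_, _) (List.mem_cons_of_mem _ List.mem_cons_self)))
  choose missing hmem hnot using hmissing
  have hmissing_inj : Function.Injective missing := fun k l h => by
    by_contra hkl
    exact chords_disjoint k l hkl _ (hmem k) _ (hmem l) h
  let pairs : Finset (Sym2 (Fin 13)) := Finset.univ.filter fun e => ¬ e.IsDiag
  have hpairs : pairs.card = 78 := by decide
  have hsub : Finset.univ.image missing ⊆ pairs := by
    intro e he
    obtain ⟨k, -, rfl⟩ := Finset.mem_image.1 he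
    exact Finset.mem_filter.2 ⟨Finset.mem_univ _, chords_not_isDiag k _ (hmem k)⟩
  have hcard : (pairs \ Finset.univ.image missing).card ≤ 74 := by
    rw [Finset.card_sdiff_of_subset hsub, Finset.card_image_of_injective _ hmissing_inj, hpairs]
    simp
  have hcover : {e : Sym2 V | e ∈ G.edgeSet ∧ ∀ v ∈ e, v ∈ Set.range x} ⊆
      Sym2.map x '' (pairs \ Finset.univ.image missing : Finset (Sym2 (Fin 13))) := by
    rintro e ⟨he, hv⟩
    induction e using Sym2.ind with
    | _ u v =>
      obtain ⟨a, rfl⟩ := hv u (by simp)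
      obtain ⟨b, rfl⟩ := hv v (by simp)
      refine ⟨s(a, b), ?_, rfl⟩
      rw [Finset.mem_coe, Finset.mem_sdiff]
      refine ⟨Finset.mem_filter.2 ⟨Finset.mem_univ _, fun hab => ?_⟩, fun hab => ?_⟩
      · exact G.ne_of_adj he (congrArg x (Sym2.mk_isDiag_iff.1 hab))
      · obtain ⟨k, -, hk⟩ := Finset.mem_image.1 hab
        exact hnot k (hk ▸ he)
  calc _ ≤ (Sym2.map x '' (pairs \ Finset.univ.image missing : Finset (Sym2 (Fin 13)))).ncard :=
        Set.ncard_le_ncard hcover (Set.toFinite _)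
    _ ≤ _ := Set.ncard_image_le (Set.toFinite _)
    _ ≤ 74 := by rwa [Set.ncard_coe_finset]
end

section
/- Let G be a 2P₇-free graph, let x₁x₂…x₁₃ be a path in G on 13 distinct vertices, and let H be a connected component of the subgraph of G induced on the vertices outside {x₁,…,x₁₃}, with |V(H)| ≥ 2. Let m(H) be the number of edges of G incident with at least one vertex of H (i.e., the edges inside H plus the edges from V(H) to {x₁,…,x₁₃}). Then m(H) ≤ 4·|V(H)|. -/
open SimpleGraph

/-- Two disjoint lists of length at least seven, each tracing a path, give a copy of `2P₇`. -/
lemma contains_twoP7_of_lists {V : Type*} {G : SimpleGraph V} {l₁ l₂ : List V}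
    (h₁ : l₁.IsChain G.Adj) (h₂ : l₂.IsChain G.Adj) (hn : (l₁ ++ l₂).Nodup)
    (hl₁ : 7 ≤ l₁.length) (hl₂ : 7 ≤ l₂.length) : Contains TwoP7 G := by
  rw [List.nodup_append] at hn
  obtain ⟨hn₁, hn₂, hd⟩ := hn
  have key : ∀ l : List V, l.IsChain G.Adj → ∀ hl : 7 ≤ l.length, ∀ a b : Fin 7,
      (SimpleGraph.pathGraph 7).Adj a b →
      G.Adj (l[a.val]'(by omega)) (l[b.val]'(by omega)) := by
    intro l h hl a b hab
    rw [List.isChain_iff_getElem] at h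
    rw [SimpleGraph.pathGraph_adj] at hab
    obtain ⟨a, ha⟩ := a
    obtain ⟨b, hb⟩ := b
    rcases hab with hab | hab
    · simp only at hab
      subst hab
      exact h a (by omega)
    · simp only at hab
      subst hab
      exact (h b (by omega)).symm
  refine ⟨⟨Sum.elim (fun i => l₁[i.val]'(by omega)) (fun i => l₂[i.val]'(by omega)), ?_⟩, ?_⟩
  · rintro (a | a) (b | b) hab
    · exact key l₁ h₁ hl₁ a b (by simpa [TwoP7] using hab)
    · simp [TwoP7] at hab
    · simp [TwoP7] at hab
    · exact key l₂ h₂ hl₂ a b (by simpa [TwoP7] using hab)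
  · rintro (a | a) (b | b) hab
    · have := (hn₁.getElem_inj_iff).1 hab
      exact congrArg Sum.inl (Fin.ext this)
    · exact absurd hab (hd _ (List.getElem_mem _) _ (List.getElem_mem _))
    · exact absurd hab.symm (hd _ (List.getElem_mem _) _ (List.getElem_mem _))
    · have := (hn₂.getElem_inj_iff).1 hab
      exact congrArg Sum.inr (Fin.ext this)

/-- A path on fourteen vertices contains `2P₇`. -/
lemma contains_twoP7_of_list {V : Type*} {G : SimpleGraph V} {l : List V}
    (h : l.IsChain G.Adj) (hn : l.Nodup) (hl : 14 ≤ l.length) : Contains TwoP7 G :=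
  contains_twoP7_of_lists (l₁ := l.take 7) (l₂ := l.drop 7) (h.take 7) (h.drop 7)
    (by simpa using hn) (by simp; omega) (by simp; omega)

lemma exists_path_list {V : Type*} {G : SimpleGraph V} {x : Fin 13 → V}
    (hinj : Function.Injective x) (hpath : ∀ i : Fin 12, G.Adj (x i.castSucc) (x i.succ)) :
    ∃ L : List V, L.length = 13 ∧ L.IsChain G.Adj ∧ L.Nodup ∧ (∀ w ∈ L, w ∈ Set.range x) ∧
      ∀ (i : Fin 13) (hi : i.val < L.length), L[i.val] = x i := by
  refine ⟨List.ofFn x, List.length_ofFn, ?_, List.nodup_ofFn.2 hinj,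
    fun w hw => List.mem_ofFn.1 hw, fun i hi => List.getElem_ofFn hi⟩
  rw [List.isChain_iff_getElem]
  intro i hi
  rw [List.length_ofFn] at hi
  rw [List.getElem_ofFn, List.getElem_ofFn]
  exact hpath ⟨i, by omega⟩

/-- Where the last vertex of a path avoiding `x` may attach to `x`, seen from one end of `x`. -/
lemma attach_bounds {V : Type*} {G : SimpleGraph V} (hfree : ¬ Contains TwoP7 G)
    {x : Fin 13 → V} (hinj : Function.Injective x)
    (hpath : ∀ i : Fin 12, G.Adj (x i.castSucc) (x i.succ))
    {Q : List V} {v : V} (hQ : (Q ++ [v]).IsChain G.Adj) (hn : (Q ++ [v]).Nodup)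
    (hx : ∀ w ∈ Q ++ [v], w ∉ Set.range x) {i : Fin 13} (hi : G.Adj v (x i)) :
    Q.length < i.val ∧ (i.val < 7 ∨ Q.length + 7 < i.val) := by
  obtain ⟨L, hlen, hL, hLn, hLx, hLi⟩ := exists_path_list hinj hpath
  have hdrop : L.drop i.val = x i :: L.drop (i.val + 1) := by
    rw [List.drop_eq_getElem_cons (by omega), hLi]
  have hxd : ∀ w ∈ Q ++ [v], ∀ y ∈ L, w ≠ y := by
    rintro w hw y hy rfl
    exact hx w hw (hLx w hy)
  have hB : ((Q ++ [v]) ++ L.drop i.val).IsChain G.Adj := by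
    refine List.IsChain.append hQ (hL.drop _) ?_
    rw [hdrop]
    simpa using hi
  have hall : (L.take i.val ++ ((Q ++ [v]) ++ L.drop i.val)).Nodup := by
    have hp : (L.take i.val ++ ((Q ++ [v]) ++ L.drop i.val)).Perm
        ((Q ++ [v]) ++ L) := by
      conv_rhs => rw [← List.take_append_drop i.val L]
      rw [← List.append_assoc (Q ++ [v]), ← List.append_assoc (L.take i.val)]
      exact List.perm_append_comm.append_right _
    rw [hp.nodup_iff, List.nodup_append]
    exact ⟨hn, hLn, hxd⟩
  constructor
  · by_contra hlt
    exact hfree (contains_twoP7_of_list hB (List.nodup_append.1 hall).2.1 (by simp; omega))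
  · by_contra hlt
    exact hfree (contains_twoP7_of_lists (hL.take _) hB hall (by simp; omega)
      (by simp; omega))

lemma path_comp_rev {V : Type*} {G : SimpleGraph V} {x : Fin 13 → V}
    (hpath : ∀ i : Fin 12, G.Adj (x i.castSucc) (x i.succ)) (i : Fin 12) :
    G.Adj ((x ∘ Fin.rev) i.castSucc) ((x ∘ Fin.rev) i.succ) := by
  have h := (hpath i.rev).symm
  rwa [← Fin.rev_castSucc, ← Fin.rev_succ] at h

lemma attach_bounds_rev {V : Type*} {G : SimpleGraph V} (hfree : ¬ Contains TwoP7 G)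
    {x : Fin 13 → V} (hinj : Function.Injective x)
    (hpath : ∀ i : Fin 12, G.Adj (x i.castSucc) (x i.succ))
    {Q : List V} {v : V} (hQ : (Q ++ [v]).IsChain G.Adj) (hn : (Q ++ [v]).Nodup)
    (hx : ∀ w ∈ Q ++ [v], w ∉ Set.range x) {i : Fin 13} (hi : G.Adj v (x i)) :
    Q.length + i.val < 12 ∧ (5 < i.val ∨ Q.length + i.val < 5) := by
  have h := attach_bounds hfree (x := x ∘ Fin.rev) (hinj.comp Fin.rev_injective)
    (path_comp_rev hpath) hQ hn
    (fun w hw => by simpa [Fin.rev_surjective.range_comp] using hx w hw) (i := i.rev)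
    (by simpa using hi)
  simp only [Fin.val_rev] at h
  omega

/-- No vertex outside the path `x` is adjacent to two consecutive vertices of `x`. -/
lemma not_adj_consecutive {V : Type*} {G : SimpleGraph V} (hfree : ¬ Contains TwoP7 G)
    {x : Fin 13 → V} (hinj : Function.Injective x)
    (hpath : ∀ i : Fin 12, G.Adj (x i.castSucc) (x i.succ)) {v : V}
    (hv : v ∉ Set.range x) (i : Fin 12) (h₁ : G.Adj v (x i.castSucc)) :
    ¬ G.Adj v (x i.succ) := by
  intro h₂
  obtain ⟨L, hlen, hL, hLn, hLx, hLi⟩ := exists_path_list hinj hpath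
  have hdrop : L.drop (i.val + 1) =
      x i.succ :: L.drop (i.val + 1 + 1) := by
    rw [List.drop_eq_getElem_cons (by omega)]
    exact congrArg (· :: _) (hLi i.succ (by rw [Fin.val_succ]; omega))
  have htake : L.take (i.val + 1) = L.take i.val ++ [x i.castSucc] := by
    rw [List.take_succ_eq_append_getElem (by omega)]
    exact congrArg (fun a => _ ++ [a]) (hLi i.castSucc (by rw [Fin.val_castSucc]; omega))
  refine hfree (contains_twoP7_of_list
    (l := L.take (i.val + 1) ++ v :: L.drop (i.val + 1)) ?_ ?_ ?_)
  · refine List.IsChain.append (hL.take _) ?_ ?_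
    · rw [List.isChain_cons]
      refine ⟨?_, hL.drop _⟩
      rw [hdrop]
      simpa using h₂
    · rw [htake]
      simpa using h₁.symm
  · rw [List.perm_middle.nodup_iff, List.take_append_drop, List.nodup_cons]
    exact ⟨fun h => hv (hLx v h), hLn⟩
  · simp
    omega

/-- A vertex outside `x` with a neighbour outside `x` has at most three neighbours on `x`. -/
lemma card_attach_le_three {V : Type*} {G : SimpleGraph V} [DecidableRel G.Adj]
    (hfree : ¬ Contains TwoP7 G) {x : Fin 13 → V} (hinj : Function.Injective x)
    (hpath : ∀ i : Fin 12, G.Adj (x i.castSucc) (x i.succ)) {u v : V}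
    (hu : u ∉ Set.range x) (hv : v ∉ Set.range x) (huv : G.Adj u v) :
    (Finset.univ.filter fun i => G.Adj v (x i)).card ≤ 3 := by
  have hb : ∀ i : Fin 13, G.Adj v (x i) → i = 2 ∨ i = 3 ∨ i = 6 ∨ i = 9 ∨ i = 10 := by
    intro i hi
    have hc : ([u] ++ [v]).IsChain G.Adj := by simpa using huv
    have hn : ([u] ++ [v]).Nodup := by simpa using huv.ne
    have hx : ∀ w ∈ [u] ++ [v], w ∉ Set.range x := by
      intro w hw
      simp only [List.cons_append, List.nil_append, List.mem_cons, List.not_mem_nil,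
        or_false] at hw
      rcases hw with rfl | rfl <;> assumption
    have h₁ := attach_bounds hfree hinj hpath hc hn hx hi
    have h₂ := attach_bounds_rev hfree hinj hpath hc hn hx hi
    simp only [List.length_singleton] at h₁ h₂
    simp only [Fin.ext_iff]
    have e₁ : ((2 : Fin 13) : ℕ) = 2 := rfl
    have e₂ : ((3 : Fin 13) : ℕ) = 3 := rfl
    have e₃ : ((6 : Fin 13) : ℕ) = 6 := rfl
    have e₄ : ((9 : Fin 13) : ℕ) = 9 := rfl
    have e₅ : ((10 : Fin 13) : ℕ) = 10 := rfl
    omega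
  have h23 : G.Adj v (x 2) → ¬ G.Adj v (x 3) := not_adj_consecutive hfree hinj hpath hv 2
  have h910 : G.Adj v (x 9) → ¬ G.Adj v (x 10) := not_adj_consecutive hfree hinj hpath hv 9
  have hsub : ∃ a b : Fin 13, (Finset.univ.filter fun i => G.Adj v (x i)) ⊆ {a, 6, b} := by
    refine ⟨if G.Adj v (x 2) then 2 else 3, if G.Adj v (x 9) then 9 else 10, ?_⟩
    intro i hi
    have hi := (Finset.mem_filter.1 hi).2
    rcases hb i hi with rfl | rfl | rfl | rfl | rfl
    · simp [hi]
    · simp [show ¬ G.Adj v (x 2) from fun h => h23 h hi]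
    · simp
    · simp [hi]
    · simp [show ¬ G.Adj v (x 9) from fun h => h910 h hi]
  obtain ⟨a, b, hab⟩ := hsub
  exact (Finset.card_le_card hab).trans Finset.card_le_three

/-- A vertex ending a three-vertex path outside `x` has at most one neighbour on `x`. -/
lemma card_attach_le_one {V : Type*} {G : SimpleGraph V} [DecidableRel G.Adj]
    (hfree : ¬ Contains TwoP7 G) {x : Fin 13 → V} (hinj : Function.Injective x)
    (hpath : ∀ i : Fin 12, G.Adj (x i.castSucc) (x i.succ)) {w u v : V}
    (hw : w ∉ Set.range x) (hu : u ∉ Set.range x) (hv : v ∉ Set.range x)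
    (hwu : G.Adj w u) (huv : G.Adj u v) (hwv : w ≠ v) :
    (Finset.univ.filter fun i => G.Adj v (x i)).card ≤ 1 := by
  rw [Finset.card_le_one_iff_subset_singleton]
  refine ⟨6, fun i hi => ?_⟩
  have hi := (Finset.mem_filter.1 hi).2
  have hc : ([w, u] ++ [v]).IsChain G.Adj := by simp [hwu, huv]
  have hn : ([w, u] ++ [v]).Nodup := by simp [hwu.ne, huv.ne, hwv]
  have hx : ∀ y ∈ [w, u] ++ [v], y ∉ Set.range x := by
    intro y hy
    simp only [List.cons_append, List.nil_append, List.mem_cons, List.not_mem_nil,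
      or_false] at hy
    rcases hy with rfl | rfl | rfl <;> assumption
  have h₁ := attach_bounds hfree hinj hpath hc hn hx hi
  have h₂ := attach_bounds_rev hfree hinj hpath hc hn hx hi
  simp only [List.length_cons, List.length_nil] at h₁ h₂
  rw [Finset.mem_singleton, Fin.ext_iff]
  have e : ((6 : Fin 13) : ℕ) = 6 := rfl
  omega

/-- In a set of minimum degree at least four whose longest path `l` has at most six vertices,
the vertices of `l` have no neighbours off `l`. -/
lemma longest_path_closed {V : Type*} [DecidableEq V] {G : SimpleGraph V} [DecidableRel G.Adj]
    {S : Finset V} (hdeg : ∀ v ∈ S, 4 ≤ (S.filter (G.Adj v)).card)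
    {l : List V} (hc : l.IsChain G.Adj) (hn : l.Nodup) (hS : ∀ v ∈ l, v ∈ S)
    (hne : l ≠ []) (h6 : l.length ≤ 6)
    (hmax : ∀ l' : List V, l'.IsChain G.Adj → l'.Nodup → (∀ v ∈ l', v ∈ S) →
      l'.length ≤ l.length) :
    ∀ v ∈ l, ∀ w ∈ S, G.Adj v w → w ∈ l := by
  have hend : ∀ v t, (v :: t).IsChain G.Adj → (v :: t).Perm l →
      ∀ w ∈ S, G.Adj v w → w ∈ l := by
    intro v t hct hp w hw hvw
    by_contra hwl
    have := hmax (w :: v :: t) (List.isChain_cons_cons.2 ⟨hvw.symm, hct⟩)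
      (List.nodup_cons.2 ⟨fun h => hwl (hp.mem_iff.1 h), hp.nodup_iff.2 hn⟩)
      (by
        intro y hy
        rcases List.mem_cons.1 hy with rfl | hy
        · exact hw
        · exact hS y (hp.mem_iff.1 hy))
    have := hp.length_eq
    simp at *
    omega
  have hnbr : ∀ v t, (v :: t).IsChain G.Adj → (v :: t).Perm l →
      S.filter (G.Adj v) ⊆ t.toFinset := by
    intro v t hct hp w hw
    rw [Finset.mem_filter] at hw
    have := hp.mem_iff.2 (hend v t hct hp w hw.1 hw.2)
    rcases List.mem_cons.1 this with rfl | h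
    · exact absurd hw.2 (G.loopless.irrefl _)
    · simpa using h
  have hcyc : ∀ l' : List V, l'.IsChain G.Adj → l'.Perm l →
      (∀ a ∈ l'.getLast?, ∀ b ∈ l'.head?, G.Adj a b) →
      ∀ v ∈ l, ∀ w ∈ S, G.Adj v w → w ∈ l := by
    intro l' hc' hp hlast v hv
    obtain ⟨s, t, rfl⟩ := List.append_of_mem (hp.mem_iff.2 hv)
    refine hend v (t ++ s) ?_ ((List.perm_append_comm (l₁ := v :: t) (l₂ := s)).trans hp)
    rw [← List.cons_append]
    rw [List.isChain_append] at hc'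
    refine List.IsChain.append hc'.2.1 hc'.1 ?_
    intro a ha b hb
    refine hlast a ?_ b ?_
    · simpa [List.getLast?_append, List.getLast?_cons] using ha
    · rw [List.head?_append, Option.mem_def.1 hb]
      rfl
  have h5 : ∀ v t, (v :: t).IsChain G.Adj → (v :: t).Perm l → 4 ≤ t.length := by
    intro v t hct hp
    exact (hdeg v (hS v (hp.mem_iff.1 List.mem_cons_self))).trans
      ((Finset.card_le_card (hnbr v t hct hp)).trans (List.toFinset_card_le t))
  -- A four-element set containing the neighbourhood of `v` is that neighbourhood.
  have hfull : ∀ v ∈ S, ∀ t : List V, t.length ≤ 4 → S.filter (G.Adj v) ⊆ t.toFinset →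
      ∀ w ∈ t, G.Adj v w := by
    intro v hv t ht hsub w hw
    have heq := Finset.eq_of_subset_of_card_le hsub
      (((List.toFinset_card_le t).trans ht).trans (hdeg v hv))
    have hw : w ∈ S.filter (G.Adj v) := heq ▸ List.mem_toFinset.2 hw
    exact (Finset.mem_filter.1 hw).2
  rcases l with _ | ⟨a, t⟩
  · exact absurd rfl hne
  have ha := hS a List.mem_cons_self
  have h4 := h5 a t hc (List.Perm.refl _)
  have hsub := hnbr a t hc (List.Perm.refl _)
  have hlen : t.length = 4 ∨ t.length = 5 := by
    simp only [List.length_cons] at h6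
    omega
  rcases hlen with hlen | hlen
  · obtain ⟨b, c, d, e, rfl⟩ := List.length_eq_four.1 hlen
    have hae := hfull a ha _ le_rfl hsub e (by simp)
    refine hcyc _ hc (List.Perm.refl _) ?_
    simpa using hae.symm
  · obtain ⟨b, c, d, e, f, rfl⟩ : ∃ b c d e f, t = [b, c, d, e, f] := by
      rcases t with _ | ⟨b, t⟩
      · simp at hlen
      obtain ⟨c, d, e, f, rfl⟩ := List.length_eq_four.1 (Nat.succ_injective hlen)
      exact ⟨b, c, d, e, f, rfl⟩
    by_cases haf : G.Adj a f
    · refine hcyc _ hc (List.Perm.refl _) ?_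
      simpa using haf.symm
    have hac : G.Adj a c := by
      refine hfull a ha [b, c, d, e] le_rfl ?_ c (by simp)
      intro w hw
      have hw' := hsub hw
      have hwf : w ≠ f := by
        rintro rfl
        exact haf (Finset.mem_filter.1 hw).2
      simpa [hwf] using hw'
    have hrev : [f, e, d, c, b, a].IsChain G.Adj := by
      simp only [List.isChain_cons_cons, List.isChain_singleton, G.adj_comm] at hc ⊢
      tauto
    have hfb : G.Adj f b := by
      refine hfull f (hS f (by simp)) [e, d, c, b] le_rfl ?_ b (by simp)
      intro w hw
      have hw' := hnbr f [e, d, c, b, a] hrev (List.reverse_perm [a, b, c, d, e, f]) hw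
      have hwa : w ≠ a := by
        rintro rfl
        exact haf (Finset.mem_filter.1 hw).2.symm
      simpa [hwa] using hw'
    have hab : G.Adj a b := (List.isChain_cons_cons.1 hc).1
    refine hcyc [a, c, d, e, f, b] ?_ ((List.perm_append_singleton b [c, d, e, f]).cons a) ?_
    · simp only [List.isChain_cons_cons, List.isChain_singleton] at hc ⊢
      tauto
    · simpa using hab.symm

/-- Effect on the degree sum of deleting a set `T` of vertices. -/
lemma sum_degree_sdiff {V : Type*} [DecidableEq V] (G : SimpleGraph V) [DecidableRel G.Adj]
    {S T : Finset V} (hT : T ⊆ S) :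
    ∑ v ∈ S, (S.filter (G.Adj v)).card =
      ∑ v ∈ S \ T, ((S \ T).filter (G.Adj v)).card + ∑ v ∈ T, (S.filter (G.Adj v)).card +
        ∑ v ∈ T, ((S \ T).filter (G.Adj v)).card := by
  have hsplit : ∀ v, (S.filter (G.Adj v)).card =
      ((S \ T).filter (G.Adj v)).card + (T.filter (G.Adj v)).card := by
    intro v
    conv_lhs => rw [← Finset.sdiff_union_of_subset hT]
    rw [Finset.filter_union, Finset.card_union_of_disjoint]
    exact Finset.disjoint_filter_filter Finset.sdiff_disjoint
  have hswap : ∑ v ∈ S \ T, (T.filter (G.Adj v)).card =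
      ∑ v ∈ T, ((S \ T).filter (G.Adj v)).card := by
    have h := Finset.sum_card_bipartiteAbove_eq_sum_card_bipartiteBelow (s := S \ T) (t := T)
      G.Adj
    simpa only [Finset.bipartiteAbove, Finset.bipartiteBelow, G.adj_comm] using h
  rw [← Finset.sum_sdiff hT, Finset.sum_congr rfl (fun v (_ : v ∈ S \ T) => hsplit v),
    Finset.sum_add_distrib, hswap]
  ring

/-- A set of vertices without a path on seven vertices has average degree at most six. -/
lemma sum_degree_le_of_no_long_path {V : Type*} [DecidableEq V] (G : SimpleGraph V)
    [DecidableRel G.Adj] (S : Finset V)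
    (h6 : ∀ l : List V, l.IsChain G.Adj → l.Nodup → (∀ v ∈ l, v ∈ S) → l.length ≤ 6) :
    ∑ v ∈ S, (S.filter (G.Adj v)).card ≤ 6 * S.card := by
  induction S using Finset.strongInduction with
  | H S ih =>
  rcases S.eq_empty_or_nonempty with rfl | ⟨s, hs⟩
  · simp
  have hrec : ∀ T ⊆ S, T.Nonempty →
      ∑ v ∈ T, (S.filter (G.Adj v)).card + ∑ v ∈ T, ((S \ T).filter (G.Adj v)).card ≤
        6 * T.card → ∑ v ∈ S, (S.filter (G.Adj v)).card ≤ 6 * S.card := by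
    intro T hT hTne hle
    have := ih (S \ T) (Finset.sdiff_ssubset hT hTne)
      (fun l hc hn hl => h6 l hc hn fun v hv => (Finset.mem_sdiff.1 (hl v hv)).1)
    rw [sum_degree_sdiff G hT]
    have := Finset.card_sdiff_add_card_eq_card hT
    omega
  by_cases hdeg : ∀ v ∈ S, 4 ≤ (S.filter (G.Adj v)).card
  · classical
    let P : ℕ → Prop := fun n =>
      ∃ l : List V, l.IsChain G.Adj ∧ l.Nodup ∧ (∀ v ∈ l, v ∈ S) ∧ l.length = n
    have hP : P 1 := ⟨[s], by simp, by simp, by simpa using hs, rfl⟩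
    obtain ⟨l, hc, hn, hl, hlen⟩ := Nat.findGreatest_spec (P := P) (n := 6) (by norm_num) hP
    have hpos : 1 ≤ l.length := hlen ▸ Nat.le_findGreatest (by norm_num) hP
    have hclosed := longest_path_closed hdeg hc hn hl (List.length_pos_iff.1 hpos) (h6 l hc hn hl)
      (fun l' hc' hn' hl' =>
        hlen ▸ Nat.le_findGreatest (h6 l' hc' hn' hl') ⟨l', hc', hn', hl', rfl⟩)
    have hTcard : l.toFinset.card ≤ 6 := (List.toFinset_card_le l).trans (h6 l hc hn hl)
    refine hrec l.toFinset (fun v hv => hl v (List.mem_toFinset.1 hv))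
      (List.toFinset_nonempty_iff l |>.2 (List.length_pos_iff.1 hpos)) ?_
    have h₁ : ∑ v ∈ l.toFinset, ((S \ l.toFinset).filter (G.Adj v)).card = 0 := by
      refine Finset.sum_eq_zero fun v hv => ?_
      rw [Finset.card_eq_zero, Finset.filter_eq_empty_iff]
      intro w hw hvw
      rw [Finset.mem_sdiff] at hw
      exact hw.2 (List.mem_toFinset.2 (hclosed v (List.mem_toFinset.1 hv) w hw.1 hvw))
    have h₂ : ∑ v ∈ l.toFinset, (S.filter (G.Adj v)).card ≤ l.toFinset.card * 6 := by
      refine Finset.sum_le_card_nsmul _ _ 6 fun v hv => ?_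
      refine (Finset.card_le_card fun w hw => ?_).trans hTcard
      rw [Finset.mem_filter] at hw
      exact List.mem_toFinset.2 (hclosed v (List.mem_toFinset.1 hv) w hw.1 hw.2)
    omega
  · push Not at hdeg
    obtain ⟨v, hv, hlt⟩ := hdeg
    refine hrec {v} (Finset.singleton_subset_iff.2 hv) (Finset.singleton_nonempty v) ?_
    have : ((S \ {v}).filter (G.Adj v)).card ≤ (S.filter (G.Adj v)).card :=
      Finset.card_le_card (Finset.filter_subset_filter _ Finset.sdiff_subset)
    simp only [Finset.sum_singleton, Finset.card_singleton]
    omega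

/-- Counting the edges that meet `H`, when edges leaving `H` end in the range of `x`. -/
lemma two_mul_incident_edges_le {V ι : Type*} [Fintype V] [Fintype ι] [DecidableEq V]
    (G : SimpleGraph V) [DecidableRel G.Adj] (x : ι → V) (H : Finset V)
    (hout : ∀ v ∈ H, ∀ w, G.Adj v w → w ∈ H ∨ w ∈ Set.range x) :
    2 * ({e : Sym2 V | e ∈ G.edgeSet ∧ ∃ v ∈ e, v ∈ H}).ncard ≤
      ∑ v ∈ H, (H.filter (G.Adj v)).card +
        2 * ∑ v ∈ H, (Finset.univ.filter fun i => G.Adj v (x i)).card := by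
  let G' : SimpleGraph V :=
    { Adj := fun a b => G.Adj a b ∧ a ∈ H ∧ b ∈ H
      symm := ⟨fun a b h => ⟨h.1.symm, h.2.2, h.2.1⟩⟩
      loopless := ⟨fun a h => G.loopless.irrefl a h.1⟩ }
  have hadj : ∀ a b, G'.Adj a b ↔ G.Adj a b ∧ a ∈ H ∧ b ∈ H := fun _ _ => Iff.rfl
  have : DecidableRel G'.Adj := fun a b => decidable_of_iff _ (hadj a b).symm
  have hin : 2 * G'.edgeFinset.card = ∑ v ∈ H, (H.filter (G.Adj v)).card := by
    rw [← G'.sum_degrees_eq_twice_card_edges, ← Finset.sum_subset (Finset.subset_univ H)]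
    · refine Finset.sum_congr rfl fun v hv => ?_
      rw [← SimpleGraph.card_neighborFinset_eq_degree]
      congr 1
      ext w
      simp [hadj, hv, and_comm]
    · intro v _ hv
      rw [← SimpleGraph.card_neighborFinset_eq_degree, Finset.card_eq_zero]
      ext w
      simp [hadj, hv]
  let C := H.sigma fun v => Finset.univ.filter fun i => G.Adj v (x i)
  have hC : C.card = ∑ v ∈ H, (Finset.univ.filter fun i => G.Adj v (x i)).card :=
    Finset.card_sigma _ _
  have hsub : {e : Sym2 V | e ∈ G.edgeSet ∧ ∃ v ∈ e, v ∈ H} ⊆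
      ((G'.edgeFinset ∪ C.image fun p => s(p.1, x p.2) : Finset (Sym2 V)) : Set (Sym2 V)) := by
    rintro e ⟨he, v, hve, hv⟩
    obtain ⟨w, rfl⟩ := Sym2.mem_iff_exists.1 hve
    rw [SimpleGraph.mem_edgeSet] at he
    rw [Finset.coe_union, Set.mem_union]
    rcases hout v hv w he with hw | ⟨i, rfl⟩
    · left
      simpa [hadj] using ⟨he, hv, hw⟩
    · right
      refine Finset.mem_coe.2 (Finset.mem_image.2 ⟨⟨v, i⟩, ?_, rfl⟩)
      simpa [C] using ⟨hv, he⟩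
  have hle := Set.ncard_le_ncard hsub (Finset.finite_toSet _)
  rw [Set.ncard_coe_finset] at hle
  have := Finset.card_union_le G'.edgeFinset (C.image fun p => s(p.1, x p.2))
  have : (C.image fun p => s(p.1, x p.2)).card ≤ C.card := Finset.card_image_le
  omega

/-- The edge bound for a connected set `H` of vertices off the path `x`. -/
lemma incident_edges_le {V : Type*} [Fintype V] [DecidableEq V] (G : SimpleGraph V)
    (hfree : ¬ Contains TwoP7 G) (x : Fin 13 → V) (hinj : Function.Injective x)
    (hpath : ∀ i : Fin 12, G.Adj (x i.castSucc) (x i.succ)) (H : Finset V)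
    (hx : ∀ v ∈ H, v ∉ Set.range x)
    (hout : ∀ v ∈ H, ∀ w, G.Adj v w → w ∈ H ∨ w ∈ Set.range x)
    (hconn : ∀ v ∈ H, ∀ w ∈ H, Relation.ReflTransGen (fun a b => G.Adj a b ∧ b ∈ H) v w)
    (hcard : 2 ≤ H.card) :
    ({e : Sym2 V | e ∈ G.edgeSet ∧ ∃ v ∈ e, v ∈ H}).ncard ≤ 4 * H.card := by
  classical
  have hcount := two_mul_incident_edges_le G x H hout
  have hnbr : ∀ v ∈ H, ∃ u ∈ H, G.Adj u v := by
    intro v hv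
    obtain ⟨w, hw, hwv⟩ := Finset.exists_mem_ne hcard v
    rcases (hconn v hv w hw).cases_head with h | ⟨u, hu, -⟩
    · exact absurd h.symm hwv
    · exact ⟨u, hu.2, hu.1.symm⟩
  by_cases hlong : ∀ v ∈ H, ∃ u ∈ H, ∃ w ∈ H, G.Adj w u ∧ G.Adj u v ∧ w ≠ v
  · have h₁ : ∑ v ∈ H, (Finset.univ.filter fun i => G.Adj v (x i)).card ≤ H.card * 1 := by
      refine Finset.sum_le_card_nsmul _ _ 1 fun v hv => ?_
      obtain ⟨u, hu, w, hw, hwu, huv, hwv⟩ := hlong v hv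
      exact card_attach_le_one hfree hinj hpath (hx w hw) (hx u hu) (hx v hv) hwu huv hwv
    have h₂ := sum_degree_le_of_no_long_path G H (fun l hc hn hl => by
      obtain ⟨L, hlen, hL, hLn, hLx, -⟩ := exists_path_list hinj hpath
      by_contra hlt
      refine hfree (contains_twoP7_of_lists hc hL ?_ (by omega) (by omega))
      rw [List.nodup_append]
      refine ⟨hn, hLn, ?_⟩
      rintro a ha b hb rfl
      exact hx a (hl a ha) (hLx a hb))
    omega
  · -- `H` is a star centred at `v`.
    push Not at hlong
    obtain ⟨v, hv, hstar⟩ := hlong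
    have hreach : ∀ w, Relation.ReflTransGen (fun a b => G.Adj a b ∧ b ∈ H) v w →
        w ∈ H ∧ (w = v ∨ G.Adj v w) := by
      intro w hw
      induction hw with
      | refl => exact ⟨hv, Or.inl rfl⟩
      | @tail b c _ h ih =>
        refine ⟨h.2, ?_⟩
        rcases ih.2 with rfl | hvb
        · exact Or.inr h.1
        · exact Or.inl (hstar b ih.1 c h.2 h.1.symm hvb.symm)
    have hstar' : ∀ w ∈ H, w = v ∨ G.Adj v w := fun w hw => (hreach w (hconn v hv w hw)).2
    have h₁ : ∑ v ∈ H, (Finset.univ.filter fun i => G.Adj v (x i)).card ≤ H.card * 3 := by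
      refine Finset.sum_le_card_nsmul _ _ 3 fun w hw => ?_
      obtain ⟨u, hu, huw⟩ := hnbr w hw
      exact card_attach_le_three hfree hinj hpath (hx u hu) (hx w hw) huw
    have h₂ : ∑ w ∈ H.erase v, (H.filter (G.Adj w)).card ≤ (H.erase v).card * 1 := by
      refine Finset.sum_le_card_nsmul _ _ 1 fun w hw => ?_
      refine (Finset.card_le_card (t := {v}) fun u hu => ?_).trans (Finset.card_singleton v).le
      rw [Finset.mem_erase] at hw
      rw [Finset.mem_filter] at hu
      have hvw := (hstar' w hw.2).resolve_left hw.1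
      exact Finset.mem_singleton.2 (hstar w hw.2 u hu.1 hu.2.symm hvw.symm)
    have h₃ := Finset.add_sum_erase H (fun w => (H.filter (G.Adj w)).card) hv
    have h₄ : (H.filter (G.Adj v)).card ≤ H.card := Finset.card_filter_le _ _
    have h₅ := Finset.card_erase_le (s := H) (a := v)
    omega

/-- Claim: if `H` is a connected component, on at least 2 vertices, of the subgraph
of a `2P₇`-free graph `G` induced on the vertices outside a 13-vertex path, then
the number of edges of `G` incident with a vertex of `H` is at most `4|V(H)|`. -/
theorem stmt17 {V : Type*} [Fintype V] (G : SimpleGraph V) (hfree : ¬ Contains TwoP7 G)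
    (x : Fin 13 → V) (hinj : Function.Injective x)
    (hpath : ∀ i : Fin 12, G.Adj (x i.castSucc) (x i.succ))
    (c : (G.induce ((Set.range x)ᶜ)).ConnectedComponent)
    (hc : 2 ≤ c.supp.ncard) :
    ({e : Sym2 V | e ∈ G.edgeSet ∧ ∃ v ∈ e, v ∈ Subtype.val '' c.supp}).ncard
      ≤ 4 * c.supp.ncard := by
  classical
  let H : Finset V := (Subtype.val '' c.supp).toFinset
  have hH : ∀ v, v ∈ H ↔ v ∈ Subtype.val '' c.supp := fun v => Set.mem_toFinset
  have hHcard : H.card = c.supp.ncard := by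
    rw [← Set.ncard_image_of_injective c.supp Subtype.val_injective, Set.ncard_eq_toFinset_card']
  simp only [← hH, ← hHcard] at hc ⊢
  refine incident_edges_le G hfree x hinj hpath H ?_ ?_ ?_ hc
  · intro v hv
    obtain ⟨v, -, rfl⟩ := (hH v).1 hv
    exact v.2
  · intro v hv w hvw
    obtain ⟨v, hvc, rfl⟩ := (hH v).1 hv
    by_cases hw : w ∈ Set.range x
    · exact Or.inr hw
    · refine Or.inl ((hH w).2 ⟨⟨w, hw⟩, ?_, rfl⟩)
      exact (SimpleGraph.ConnectedComponent.mem_supp_congr_adj c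
        (show (G.induce ((Set.range x)ᶜ)).Adj v ⟨w, hw⟩ from hvw)).1 hvc
  · intro v hv w hw
    obtain ⟨v, hvc, rfl⟩ := (hH v).1 hv
    obtain ⟨w, hwc, rfl⟩ := (hH w).1 hw
    have hr : (G.induce ((Set.range x)ᶜ)).Reachable v w :=
      SimpleGraph.ConnectedComponent.exact (hvc.trans hwc.symm)
    rw [SimpleGraph.reachable_iff_reflTransGen] at hr
    clear hwc hw
    have key : Relation.ReflTransGen (fun a b => G.Adj a b ∧ b ∈ H) v.1 w.1 ∧ w ∈ c.supp := by
      induction hr with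
      | refl => exact ⟨Relation.ReflTransGen.refl, hvc⟩
      | @tail a b _ hab ih =>
        have hb := (SimpleGraph.ConnectedComponent.mem_supp_congr_adj c hab).1 ih.2
        exact ⟨ih.1.tail ⟨hab, (hH b).2 ⟨b, hb, rfl⟩⟩, hb⟩
    exact key.1
end
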